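/- Let q be not a root of unity and let Z be the U_q(sl2) Verma module of highest weight λ with q^{2λ} = −q^{-1}·q^{a} for no rational a making factors vanish (e.g. q^{2λ} = −q^{-1}). Let V be the finite-dimensional simple module of highest weight ℓ ∈ Z_{≥0}. Then for every 0 ≤ m ≤ ℓ, the extremal twist eigenvalue \prod_{k=1}^{m} [λ + 1 + (ℓ − 2m) + k]_q / [λ + 1 − k]_q is nonzero; consequently V ⊗ Z decomposes as a direct sum of ℓ+1 Verma modules of highest weights λ + ℓ − 2m, m = 0, ..., ℓ. -/

import Mathlib

open Finset

noncomputable section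

/-- `(u - u⁻¹)/(q - q⁻¹)`; with `u = q^z` this is the q-number `[z]_q`. -/
def qNum (q u : ℂ) : ℂ := (u - u⁻¹) / (q - q⁻¹)

/-- `e` on the `(ℓ+1)`-dimensional simple module `V(ℓ)`: `e v_j = [j]_q[ℓ-j+1]_q v_{j-1}`. -/
def EvMat (q : ℂ) (ℓ : ℕ) : Matrix (Fin (ℓ + 1)) (Fin (ℓ + 1)) ℂ :=
  fun i j => if (i : ℕ) + 1 = (j : ℕ) then qNum q (q ^ (j : ℤ)) * qNum q (q ^ ((ℓ : ℤ) - j + 1)) else 0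

/-- `f` on `V(ℓ)`: `f v_j = v_{j+1}`. -/
def FvMat (ℓ : ℕ) : Matrix (Fin (ℓ + 1)) (Fin (ℓ + 1)) ℂ :=
  fun i j => if (i : ℕ) = (j : ℕ) + 1 then 1 else 0

/-- `K = q^h` on `V(ℓ)`. -/
def KvMat (q : ℂ) (ℓ : ℕ) : Matrix (Fin (ℓ + 1)) (Fin (ℓ + 1)) ℂ :=
  Matrix.diagonal fun j => q ^ ((ℓ : ℤ) - 2 * (j : ℕ))

/-- `K⁻¹` on `V(ℓ)`. -/
def KviMat (q : ℂ) (ℓ : ℕ) : Matrix (Fin (ℓ + 1)) (Fin (ℓ + 1)) ℂ :=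
  Matrix.diagonal fun j => q ^ (-((ℓ : ℤ) - 2 * (j : ℕ)))

/-- `e` on the Verma module `M_μ` with `K`-highest eigenvalue `κm = q^μ`
(basis `f^k 1_μ`, `k : ℕ`): `e f^k 1_μ = [k]_q[μ-k+1]_q f^{k-1} 1_μ`. -/
def EM (q κm : ℂ) : (ℕ →₀ ℂ) →ₗ[ℂ] (ℕ →₀ ℂ) :=
  Finsupp.lsum ℂ fun k =>
    (qNum q (q ^ (k : ℤ)) * qNum q (κm * q ^ (1 - (k : ℤ)))) • Finsupp.lsingle (k - 1)

/-- `f` on the Verma module. -/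
def FM : (ℕ →₀ ℂ) →ₗ[ℂ] (ℕ →₀ ℂ) :=
  Finsupp.lsum ℂ fun k => Finsupp.lsingle (k + 1)

/-- `K` on the Verma module. -/
def KM (q κm : ℂ) : (ℕ →₀ ℂ) →ₗ[ℂ] (ℕ →₀ ℂ) :=
  Finsupp.lsum ℂ fun k => (κm * q ^ (-2 * (k : ℤ))) • Finsupp.lsingle k

/-- `e` on `⊕_{m=0}^{ℓ} M_{λ+ℓ-2m}` (basis indexed by `(m, k)`), `κ = q^λ`. -/
def ED (q κ : ℂ) (ℓ : ℕ) : ((Fin (ℓ + 1) × ℕ) →₀ ℂ) →ₗ[ℂ] ((Fin (ℓ + 1) × ℕ) →₀ ℂ) :=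
  Finsupp.lsum ℂ fun mk =>
    (qNum q (q ^ (mk.2 : ℤ)) *
        qNum q (κ * q ^ ((ℓ : ℤ) - 2 * (mk.1 : ℕ)) * q ^ (1 - (mk.2 : ℤ)))) •
      Finsupp.lsingle (mk.1, mk.2 - 1)

/-- `f` on the direct sum. -/
def FD (ℓ : ℕ) : ((Fin (ℓ + 1) × ℕ) →₀ ℂ) →ₗ[ℂ] ((Fin (ℓ + 1) × ℕ) →₀ ℂ) :=
  Finsupp.lsum ℂ fun mk => Finsupp.lsingle (mk.1, mk.2 + 1)

/-- `K` on the direct sum. -/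
def KD (q κ : ℂ) (ℓ : ℕ) : ((Fin (ℓ + 1) × ℕ) →₀ ℂ) →ₗ[ℂ] ((Fin (ℓ + 1) × ℕ) →₀ ℂ) :=
  Finsupp.lsum ℂ fun mk =>
    (κ * q ^ ((ℓ : ℤ) - 2 * (mk.1 : ℕ)) * q ^ (-2 * (mk.2 : ℤ))) • Finsupp.lsingle mk

section QNumbers

lemma sub_inv_ne_zero_of_sq_ne_one {u : ℂ} (hu : u ≠ 0) (h : u ^ 2 ≠ 1) : u - u⁻¹ ≠ 0 := by
  intro h0
  apply h
  field_simp at h0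
  linear_combination h0

lemma qNum_ne_zero {q u : ℂ} (hq0 : q ≠ 0) (hq2 : q ^ 2 ≠ 1) (hu : u ≠ 0) (h : u ^ 2 ≠ 1) :
    qNum q u ≠ 0 :=
  div_ne_zero (sub_inv_ne_zero_of_sq_ne_one hu h) (sub_inv_ne_zero_of_sq_ne_one hq0 hq2)

lemma qNum_one (q : ℂ) : qNum q 1 = 0 := by simp [qNum]

lemma qNum_mul_sub_mul {q a b : ℂ} (hq0 : q ≠ 0) (hq2 : q ^ 2 ≠ 1) (ha : a ≠ 0) (hb : b ≠ 0) :
    qNum q (a * q) * qNum q b - qNum q a * qNum q (b * q) = qNum q (b * a⁻¹) := by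
  have h : q ^ 2 - 1 ≠ 0 := sub_ne_zero.2 hq2
  have h' := sub_inv_ne_zero_of_sq_ne_one hq0 hq2
  unfold qNum
  field_simp
  ring

lemma qNum_mul_add {q a b : ℂ} : qNum q a * b + a⁻¹ * qNum q b = qNum q (a * b) := by
  unfold qNum
  rw [mul_inv]
  ring

lemma zpow_ne_one_of_pow_ne_one {q : ℂ} (hq : ∀ n : ℕ, 0 < n → q ^ n ≠ 1) {n : ℤ} (hn : n ≠ 0) :
    q ^ n ≠ 1 := by
  intro h
  refine hq n.natAbs (Int.natAbs_pos.2 hn) ?_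
  rcases Int.natAbs_eq n with h' | h' <;> rw [h'] at h
  · exact_mod_cast h
  · rw [zpow_neg, inv_eq_one] at h
    exact_mod_cast h

lemma qNum_zpow_ne_zero {q : ℂ} (hq0 : q ≠ 0) (hq : ∀ n : ℕ, 0 < n → q ^ n ≠ 1) {n : ℤ}
    (hn : n ≠ 0) : qNum q (q ^ n) ≠ 0 := by
  refine qNum_ne_zero hq0 (hq 2 two_pos) (zpow_ne_zero _ hq0) ?_
  rw [← zpow_natCast, ← zpow_mul]
  exact zpow_ne_one_of_pow_ne_one hq (by simpa using hn)

lemma qNum_mul_zpow_ne_zero {q κ : ℂ} (hq0 : q ≠ 0) (hq : ∀ n : ℕ, 0 < n → q ^ n ≠ 1)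
    (hκ : κ ≠ 0) (hκ2 : κ ^ 2 = -q⁻¹) (n : ℤ) : qNum q (κ * q ^ n) ≠ 0 := by
  refine qNum_ne_zero hq0 (hq 2 two_pos) (mul_ne_zero hκ (zpow_ne_zero _ hq0)) fun h => ?_
  refine zpow_ne_one_of_pow_ne_one hq (n := (2 * n - 1) * 2) (by omega) ?_
  have e : q ^ (2 * n - 1) = (q ^ n) ^ 2 * q⁻¹ := by
    rw [zpow_sub_one₀ hq0, mul_comm 2 n, zpow_mul]
    norm_cast
  rw [mul_pow, hκ2] at h
  rw [zpow_mul, e]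
  norm_cast
  linear_combination (-q⁻¹ * (q ^ n) ^ 2 + 1) * h

end QNumbers

section TensorProductAction

open TensorProduct

/-- The standard basis vectors of `V(ℓ)`, extended by `v_j = 0` for `j > ℓ`. -/
def stdVec (ℓ j : ℕ) : Fin (ℓ + 1) → ℂ := fun i => if (i : ℕ) = j then 1 else 0

lemma stdVec_eq_zero {ℓ j : ℕ} (h : ℓ < j) : stdVec ℓ j = 0 := by
  ext i
  have := i.2
  simp only [stdVec, Pi.zero_apply, ite_eq_right_iff]
  omega

lemma stdVec_coe {ℓ : ℕ} (i : Fin (ℓ + 1)) : stdVec ℓ i = Pi.single i 1 := by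
  ext j
  simp [stdVec, Pi.single_apply, Fin.ext_iff]

lemma EvMat_stdVec (q : ℂ) (ℓ j : ℕ) : Matrix.toLin' (EvMat q ℓ) (stdVec ℓ j) =
    (qNum q (q ^ (j : ℤ)) * qNum q (q ^ ((ℓ : ℤ) - j + 1))) • stdVec ℓ (j - 1) := by
  rcases le_or_gt j ℓ with h | h
  · obtain ⟨i, rfl⟩ : ∃ i : Fin (ℓ + 1), (i : ℕ) = j := ⟨⟨j, by omega⟩, rfl⟩
    ext r
    rw [stdVec_coe, Matrix.toLin'_apply, Matrix.mulVec_single_one]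
    rcases Nat.eq_zero_or_pos (i : ℕ) with h0 | h0
    · simp [h0, EvMat, qNum_one]
    · have : ((r : ℕ) + 1 = i) ↔ ((r : ℕ) = i - 1) := by omega
      simp [EvMat, stdVec, this]
  · rw [stdVec_eq_zero h, map_zero]
    rcases Nat.lt_or_ge (ℓ + 1) j with h' | h'
    · rw [stdVec_eq_zero (by omega), smul_zero]
    · have : (ℓ : ℤ) - j + 1 = 0 := by omega
      simp [this, qNum_one]

lemma FvMat_stdVec (ℓ j : ℕ) :
    Matrix.toLin' (FvMat ℓ) (stdVec ℓ j) = stdVec ℓ (j + 1) := by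
  rcases le_or_gt j ℓ with h | h
  · obtain ⟨i, rfl⟩ : ∃ i : Fin (ℓ + 1), (i : ℕ) = j := ⟨⟨j, by omega⟩, rfl⟩
    ext r
    rw [stdVec_coe, Matrix.toLin'_apply, Matrix.mulVec_single_one]
    simp [FvMat, stdVec]
  · rw [stdVec_eq_zero h, map_zero, stdVec_eq_zero (by omega)]

lemma diagonal_stdVec (ℓ j : ℕ) (g : ℕ → ℂ) :
    Matrix.toLin' (Matrix.diagonal fun i : Fin (ℓ + 1) => g i) (stdVec ℓ j) =
      g j • stdVec ℓ j := by
  ext r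
  rw [Matrix.toLin'_apply, Matrix.mulVec_diagonal]
  by_cases h : (r : ℕ) = j <;> simp [stdVec, h]

/-- The action of `Δ(e)` on `V(ℓ) ⊗ M`. -/
def tensorE (q κ : ℂ) (ℓ : ℕ) :
    (Fin (ℓ + 1) → ℂ) ⊗[ℂ] (ℕ →₀ ℂ) →ₗ[ℂ] (Fin (ℓ + 1) → ℂ) ⊗[ℂ] (ℕ →₀ ℂ) :=
  TensorProduct.map (Matrix.toLin' (EvMat q ℓ)) (KM q κ) +
    TensorProduct.map LinearMap.id (EM q κ)

/-- The action of `Δ(f)` on `V(ℓ) ⊗ M`. -/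
def tensorF (q : ℂ) (ℓ : ℕ) :
    (Fin (ℓ + 1) → ℂ) ⊗[ℂ] (ℕ →₀ ℂ) →ₗ[ℂ] (Fin (ℓ + 1) → ℂ) ⊗[ℂ] (ℕ →₀ ℂ) :=
  TensorProduct.map (Matrix.toLin' (FvMat ℓ)) LinearMap.id +
    TensorProduct.map (Matrix.toLin' (KviMat q ℓ)) FM

/-- The action of `Δ(K)` on `V(ℓ) ⊗ M`. -/
def tensorK (q κ : ℂ) (ℓ : ℕ) :
    (Fin (ℓ + 1) → ℂ) ⊗[ℂ] (ℕ →₀ ℂ) →ₗ[ℂ] (Fin (ℓ + 1) → ℂ) ⊗[ℂ] (ℕ →₀ ℂ) :=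
  TensorProduct.map (Matrix.toLin' (KvMat q ℓ)) (KM q κ)

/-- The vector `v_j ⊗ f^k 1`. -/
def tensorVec (ℓ j k : ℕ) : (Fin (ℓ + 1) → ℂ) ⊗[ℂ] (ℕ →₀ ℂ) :=
  stdVec ℓ j ⊗ₜ[ℂ] Finsupp.single k 1

lemma tensorE_tensorVec (q κ : ℂ) (ℓ j k : ℕ) : tensorE q κ ℓ (tensorVec ℓ j k) =
    (qNum q (q ^ (j : ℤ)) * qNum q (q ^ ((ℓ : ℤ) - j + 1)) * (κ * q ^ (-2 * (k : ℤ)))) •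
        tensorVec ℓ (j - 1) k +
      (qNum q (q ^ (k : ℤ)) * qNum q (κ * q ^ (1 - (k : ℤ)))) • tensorVec ℓ j (k - 1) := by
  simp only [tensorE, tensorVec, LinearMap.add_apply, TensorProduct.map_tmul, EvMat_stdVec, KM, EM,
    Finsupp.lsum_single, LinearMap.smul_apply, Finsupp.lsingle_apply, LinearMap.id_apply,
    TensorProduct.tmul_smul, TensorProduct.smul_tmul', smul_smul]
  rw [mul_comm (κ * q ^ (-2 * (k : ℤ)))]

lemma tensorF_tensorVec (q : ℂ) (ℓ j k : ℕ) : tensorF q ℓ (tensorVec ℓ j k) =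
    tensorVec ℓ (j + 1) k + q ^ (-((ℓ : ℤ) - 2 * (j : ℕ))) • tensorVec ℓ j (k + 1) := by
  simp only [tensorF, tensorVec, LinearMap.add_apply, TensorProduct.map_tmul, FvMat_stdVec, FM,
    KviMat, diagonal_stdVec ℓ j fun i => q ^ (-((ℓ : ℤ) - 2 * (i : ℕ))),
    Finsupp.lsum_single, Finsupp.lsingle_apply, LinearMap.id_apply, TensorProduct.smul_tmul']

lemma tensorK_tensorVec {q : ℂ} (hq0 : q ≠ 0) (κ : ℂ) (ℓ j k : ℕ) :
    tensorK q κ ℓ (tensorVec ℓ j k) =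
      (κ * q ^ ((ℓ : ℤ) - 2 * (j + k : ℕ))) • tensorVec ℓ j k := by
  simp only [tensorK, tensorVec, TensorProduct.map_tmul, KM,
    KvMat, diagonal_stdVec ℓ j fun i => q ^ ((ℓ : ℤ) - 2 * (i : ℕ)),
    Finsupp.lsum_single, LinearMap.smul_apply, Finsupp.lsingle_apply,
    TensorProduct.smul_tmul_smul]
  congr 1
  rw [mul_left_comm, ← zpow_add₀ hq0]
  push_cast
  ring_nf

lemma tensorE_tensorF_tensorVec {q κ : ℂ} (hq0 : q ≠ 0) (hq2 : q ^ 2 ≠ 1) (hκ : κ ≠ 0)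
    (ℓ j k : ℕ) :
    tensorE q κ ℓ (tensorF q ℓ (tensorVec ℓ j k)) =
      tensorF q ℓ (tensorE q κ ℓ (tensorVec ℓ j k)) +
        qNum q (κ * q ^ ((ℓ : ℤ) - 2 * (j + k : ℕ))) • tensorVec ℓ j k := by
  have hz : ∀ n : ℤ, q ^ n ≠ 0 := fun n => zpow_ne_zero _ hq0
  have hV := qNum_mul_sub_mul hq0 hq2 (hz j) (hz (ℓ - j))
  have hM := qNum_mul_sub_mul hq0 hq2 (hz k) (mul_ne_zero hκ (hz (-k)))
  have hVM := qNum_mul_add (q := q) (a := q ^ ((ℓ : ℤ) - 2 * j)) (b := κ * q ^ (-2 * (k : ℤ)))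
  have e1 : q ^ ((ℓ : ℤ) - j) * (q ^ (j : ℤ))⁻¹ = q ^ ((ℓ : ℤ) - 2 * j) := by
    rw [← zpow_neg, ← zpow_add₀ hq0]; ring_nf
  have e2 : κ * q ^ (-(k : ℤ)) * (q ^ (k : ℤ))⁻¹ = κ * q ^ (-2 * (k : ℤ)) := by
    rw [← zpow_neg, mul_assoc, ← zpow_add₀ hq0]; ring_nf
  have e3 : q ^ ((ℓ : ℤ) - 2 * j) * (κ * q ^ (-2 * (k : ℤ))) =
      κ * q ^ ((ℓ : ℤ) - 2 * (j + k : ℕ)) := by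
    rw [mul_left_comm, ← zpow_add₀ hq0]; push_cast; ring_nf
  have e4 : κ * q ^ (-(k : ℤ)) * q = κ * q ^ (1 - (k : ℤ)) := by
    rw [mul_assoc, ← zpow_add_one₀ hq0]; ring_nf
  have e5 : q ^ ((ℓ : ℤ) - (j + 1 : ℕ) + 1) = q ^ ((ℓ : ℤ) - j) := by push_cast; ring_nf
  have e6 : q ^ (1 - ((k + 1 : ℕ) : ℤ)) = q ^ (-(k : ℤ)) := by push_cast; ring_nf
  have e7 : q ^ ((j + 1 : ℕ) : ℤ) = q ^ (j : ℤ) * q := by push_cast; rw [zpow_add_one₀ hq0]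
  have e8 : q ^ ((k + 1 : ℕ) : ℤ) = q ^ (k : ℤ) * q := by push_cast; rw [zpow_add_one₀ hq0]
  rw [e1, ← zpow_add_one₀ hq0 (_ - _)] at hV
  rw [e2, e4] at hM
  rw [e3, ← hV, ← hM, ← zpow_neg] at hVM
  rw [← hVM, tensorF_tensorVec, map_add, map_smul, tensorE_tensorVec, tensorE_tensorVec,
    tensorE_tensorVec, map_add, map_smul, map_smul, tensorF_tensorVec, tensorF_tensorVec,
    e5, e6, e7, e8]
  have hj : qNum q (q ^ (j : ℤ)) • tensorVec ℓ (j - 1 + 1) k =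
      qNum q (q ^ (j : ℤ)) • tensorVec ℓ j k := by
    rcases j with _ | j <;> simp [qNum_one]
  have hk : qNum q (q ^ (k : ℤ)) • tensorVec ℓ j (k - 1 + 1) =
      qNum q (q ^ (k : ℤ)) • tensorVec ℓ j k := by
    rcases k with _ | k <;> simp [qNum_one]
  have hjk : (qNum q (q ^ (j : ℤ)) * q ^ (-2 * (k : ℤ)) *
        q ^ (-((ℓ : ℤ) - 2 * (j - 1 : ℕ)))) • tensorVec ℓ (j - 1) (k + 1) =
      (qNum q (q ^ (j : ℤ)) * q ^ (-2 * ((k + 1 : ℕ) : ℤ)) *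
        q ^ (-((ℓ : ℤ) - 2 * j))) • tensorVec ℓ (j - 1) (k + 1) := by
    rcases j with _ | j
    · simp [qNum_one]
    · congr 1
      rw [mul_assoc, mul_assoc, ← zpow_add₀ hq0, ← zpow_add₀ hq0]
      push_cast
      ring_nf
  simp only [add_tsub_cancel_right]
  linear_combination (norm := module)
    (-(qNum q (q ^ ((ℓ : ℤ) - j + 1)) * (κ * q ^ (-2 * (k : ℤ))))) • hj
    - (qNum q (κ * q ^ (1 - (k : ℤ))) * q ^ (-((ℓ : ℤ) - 2 * j))) • hk
    - (qNum q (q ^ ((ℓ : ℤ) - j + 1)) * κ) • hjk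

end TensorProductAction

section WeightSpaces

open TensorProduct

/-- The span of the `v_j ⊗ f^k 1` with `j + k = n`: the weight space of weight `λ + ℓ - 2n`. -/
def wtSpace (ℓ n : ℕ) : Submodule ℂ ((Fin (ℓ + 1) → ℂ) ⊗[ℂ] (ℕ →₀ ℂ)) :=
  Submodule.span ℂ {x | ∃ j k, j + k = n ∧ tensorVec ℓ j k = x}

lemma tensorVec_mem_wtSpace (ℓ j k : ℕ) : tensorVec ℓ j k ∈ wtSpace ℓ (j + k) :=
  Submodule.subset_span ⟨j, k, rfl, rfl⟩

lemma tensorF_mem_wtSpace (q : ℂ) {ℓ n : ℕ} {x : (Fin (ℓ + 1) → ℂ) ⊗[ℂ] (ℕ →₀ ℂ)}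
    (hx : x ∈ wtSpace ℓ n) : tensorF q ℓ x ∈ wtSpace ℓ (n + 1) := by
  suffices wtSpace ℓ n ≤ (wtSpace ℓ (n + 1)).comap (tensorF q ℓ) from this hx
  refine Submodule.span_le.2 ?_
  rintro _ ⟨j, k, rfl, rfl⟩
  simp only [Submodule.comap_coe, Set.mem_preimage, SetLike.mem_coe, tensorF_tensorVec]
  refine add_mem ?_ (Submodule.smul_mem _ _ ?_)
  · rw [add_right_comm]; exact tensorVec_mem_wtSpace _ _ _
  · exact tensorVec_mem_wtSpace ℓ j (k + 1)

lemma tensorF_pow_mem_wtSpace (q : ℂ) {ℓ n : ℕ} {x : (Fin (ℓ + 1) → ℂ) ⊗[ℂ] (ℕ →₀ ℂ)}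
    (hx : x ∈ wtSpace ℓ n) (k : ℕ) : (tensorF q ℓ ^ k) x ∈ wtSpace ℓ (n + k) := by
  induction k with
  | zero => simpa using hx
  | succ k ih =>
    rw [pow_succ', Module.End.mul_apply]
    exact tensorF_mem_wtSpace q ih

lemma tensorK_of_mem_wtSpace {q : ℂ} (hq0 : q ≠ 0) (κ : ℂ) {ℓ n : ℕ}
    {x : (Fin (ℓ + 1) → ℂ) ⊗[ℂ] (ℕ →₀ ℂ)} (hx : x ∈ wtSpace ℓ n) :
    tensorK q κ ℓ x = (κ * q ^ ((ℓ : ℤ) - 2 * n)) • x := by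
  induction hx using Submodule.span_induction with
  | mem x h => obtain ⟨j, k, rfl, rfl⟩ := h; exact tensorK_tensorVec hq0 κ ℓ j k
  | zero => simp
  | add x y _ _ hx hy => rw [map_add, hx, hy, smul_add]
  | smul a x _ hx => rw [map_smul, hx, smul_comm]

lemma tensorE_tensorF_of_mem_wtSpace {q κ : ℂ} (hq0 : q ≠ 0) (hq2 : q ^ 2 ≠ 1) (hκ : κ ≠ 0)
    {ℓ n : ℕ} {x : (Fin (ℓ + 1) → ℂ) ⊗[ℂ] (ℕ →₀ ℂ)} (hx : x ∈ wtSpace ℓ n) :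
    tensorE q κ ℓ (tensorF q ℓ x) =
      tensorF q ℓ (tensorE q κ ℓ x) + qNum q (κ * q ^ ((ℓ : ℤ) - 2 * n)) • x := by
  induction hx using Submodule.span_induction with
  | mem x h => obtain ⟨j, k, rfl, rfl⟩ := h; exact tensorE_tensorF_tensorVec hq0 hq2 hκ ℓ j k
  | zero => simp
  | add x y _ _ hx hy => simp only [map_add, hx, hy, smul_add]; abel
  | smul a x _ hx => simp only [map_smul, hx, smul_add, smul_comm a]

lemma tensorE_tensorF_pow {q κ : ℂ} (hq0 : q ≠ 0) (hq2 : q ^ 2 ≠ 1) (hκ : κ ≠ 0)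
    {ℓ n : ℕ} {x : (Fin (ℓ + 1) → ℂ) ⊗[ℂ] (ℕ →₀ ℂ)} (hx : x ∈ wtSpace ℓ n)
    (hE : tensorE q κ ℓ x = 0) (k : ℕ) :
    tensorE q κ ℓ ((tensorF q ℓ ^ k) x) =
      (qNum q (q ^ (k : ℤ)) * qNum q (κ * q ^ ((ℓ : ℤ) - 2 * n) * q ^ (1 - (k : ℤ)))) •
        (tensorF q ℓ ^ (k - 1)) x := by
  induction k with
  | zero => simp [hE, qNum_one]
  | succ k ih =>
    have hk : qNum q (q ^ (k : ℤ)) • tensorF q ℓ ((tensorF q ℓ ^ (k - 1)) x) =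
        qNum q (q ^ (k : ℤ)) • (tensorF q ℓ ^ k) x := by
      rcases k with _ | k
      · simp [qNum_one]
      · rw [add_tsub_cancel_right, pow_succ' _ k, Module.End.mul_apply]
    have hz : ∀ n : ℤ, q ^ n ≠ 0 := fun n => zpow_ne_zero _ hq0
    have h := qNum_mul_sub_mul hq0 hq2 (hz k)
      (mul_ne_zero (mul_ne_zero hκ (hz ((ℓ : ℤ) - 2 * n))) (hz (-k)))
    have e1 : κ * q ^ ((ℓ : ℤ) - 2 * n) * q ^ (-(k : ℤ)) * (q ^ (k : ℤ))⁻¹ =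
        κ * q ^ ((ℓ : ℤ) - 2 * (n + k : ℕ)) := by
      rw [← zpow_neg, mul_assoc, mul_assoc, ← zpow_add₀ hq0, ← zpow_add₀ hq0]
      push_cast
      ring_nf
    have e2 : q ^ (-(k : ℤ)) * q = q ^ (1 - (k : ℤ)) := by
      rw [← zpow_add_one₀ hq0]; ring_nf
    have e3 : q ^ (1 - ((k + 1 : ℕ) : ℤ)) = q ^ (-(k : ℤ)) := by push_cast; ring_nf
    have e4 : q ^ ((k + 1 : ℕ) : ℤ) = q ^ (k : ℤ) * q := by push_cast; rw [zpow_add_one₀ hq0]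
    rw [e1, mul_assoc _ _ q, e2] at h
    rw [pow_succ', Module.End.mul_apply,
      tensorE_tensorF_of_mem_wtSpace hq0 hq2 hκ (tensorF_pow_mem_wtSpace q hx k), ih, map_smul,
      ← h, e3, e4, add_tsub_cancel_right]
    linear_combination (norm := module)
      qNum q (κ * q ^ ((ℓ : ℤ) - 2 * n) * q ^ (1 - (k : ℤ))) • hk

/-- The coefficients of the singular vector of weight `λ + ℓ - 2m`, normalised to start at `1`. -/
def singCoeff (q κ : ℂ) (ℓ m : ℕ) : ℕ → ℂ
  | 0 => 1
  | j + 1 => -(singCoeff q κ ℓ m j *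
      (qNum q (q ^ ((m : ℤ) - j)) * qNum q (κ * q ^ (1 - ((m : ℤ) - j)))) /
      (qNum q (q ^ ((j : ℤ) + 1)) * qNum q (q ^ ((ℓ : ℤ) - j)) *
        (κ * q ^ (-2 * ((m : ℤ) - j - 1)))))

/-- The singular vector of weight `λ + ℓ - 2m` in `V(ℓ) ⊗ M_λ`. -/
def singVec (q κ : ℂ) (ℓ m : ℕ) : (Fin (ℓ + 1) → ℂ) ⊗[ℂ] (ℕ →₀ ℂ) :=
  ∑ j ∈ range (m + 1), singCoeff q κ ℓ m j • tensorVec ℓ j (m - j)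

lemma singVec_mem_wtSpace (q κ : ℂ) (ℓ m : ℕ) : singVec q κ ℓ m ∈ wtSpace ℓ m := by
  refine sum_mem fun j hj => Submodule.smul_mem _ _ ?_
  have h := tensorVec_mem_wtSpace ℓ j (m - j)
  rwa [Nat.add_sub_cancel' (by simpa [Nat.lt_succ_iff] using hj)] at h

lemma tensorE_singVec {q κ : ℂ} (hq0 : q ≠ 0) (hq : ∀ n : ℕ, 0 < n → q ^ n ≠ 1) (hκ : κ ≠ 0)
    {ℓ m : ℕ} (hm : m ≤ ℓ) : tensorE q κ ℓ (singVec q κ ℓ m) = 0 := by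
  simp only [singVec, map_sum, map_smul, tensorE_tensorVec, smul_add, Finset.sum_add_distrib]
  rw [Finset.sum_range_succ', Finset.sum_range_succ _ m]
  simp only [Nat.cast_zero, zpow_zero, qNum_one, zero_mul, zero_smul, smul_zero, add_zero,
    Nat.sub_self]
  rw [← Finset.sum_add_distrib]
  refine Finset.sum_eq_zero fun j hj => ?_
  have hj : j < m := Finset.mem_range.1 hj
  have h1 : qNum q (q ^ ((j : ℤ) + 1)) ≠ 0 := qNum_zpow_ne_zero hq0 hq (by omega)
  have h2 : qNum q (q ^ ((ℓ : ℤ) - j)) ≠ 0 := qNum_zpow_ne_zero hq0 hq (by omega)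
  have h3 : κ * q ^ (-2 * ((m : ℤ) - j - 1)) ≠ 0 := mul_ne_zero hκ (zpow_ne_zero _ hq0)
  have c1 : ((m - (j + 1) : ℕ) : ℤ) = (m : ℤ) - j - 1 := by omega
  have c2 : ((m - j : ℕ) : ℤ) = (m : ℤ) - j := by omega
  have c3 : (ℓ : ℤ) - (j + 1 : ℕ) + 1 = ℓ - j := by push_cast; ring
  rw [smul_smul, smul_smul, add_tsub_cancel_right, Nat.sub_sub, c1, c2, c3, ← add_smul]
  convert zero_smul ℂ _ using 2
  rw [singCoeff]
  push_cast
  field_simp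
  ring

end WeightSpaces

section Decomposition

open TensorProduct

/-- The basis `v_j ⊗ f^k 1` of `V(ℓ) ⊗ M`. -/
def tensorBasis (ℓ : ℕ) : Module.Basis (Fin (ℓ + 1) × ℕ) ℂ ((Fin (ℓ + 1) → ℂ) ⊗[ℂ] (ℕ →₀ ℂ)) :=
  (Pi.basisFun ℂ (Fin (ℓ + 1))).tensorProduct Finsupp.basisSingleOne

lemma tensorBasis_apply (ℓ : ℕ) (p : Fin (ℓ + 1) × ℕ) :
    tensorBasis ℓ p = tensorVec ℓ p.1 p.2 := by
  simp [tensorBasis, tensorVec, stdVec_coe, Module.Basis.tensorProduct_apply']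

lemma tensorBasis_repr_tensorVec {ℓ j : ℕ} (hj : j < ℓ + 1) (k : ℕ) :
    (tensorBasis ℓ).repr (tensorVec ℓ j k) = Finsupp.single (⟨j, hj⟩, k) 1 := by
  simpa only [tensorBasis_apply] using (tensorBasis ℓ).repr_self (⟨j, hj⟩, k)

lemma tensorBasis_repr_mem_supported {ℓ n : ℕ} {x : (Fin (ℓ + 1) → ℂ) ⊗[ℂ] (ℕ →₀ ℂ)}
    (hx : x ∈ wtSpace ℓ n) :
    (tensorBasis ℓ).repr x ∈
      Finsupp.supported ℂ ℂ {p : Fin (ℓ + 1) × ℕ | (p.1 : ℕ) + p.2 = n} := by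
  induction hx using Submodule.span_induction with
  | mem x h =>
    obtain ⟨j, k, rfl, rfl⟩ := h
    rcases le_or_gt j ℓ with h | h
    · rw [tensorBasis_repr_tensorVec (Nat.lt_succ_of_le h)]
      exact Finsupp.single_mem_supported ℂ _ rfl
    · simp [tensorVec, stdVec_eq_zero h]
  | zero => simp
  | add x y _ _ hx hy => rw [map_add]; exact add_mem hx hy
  | smul a x _ hx => rw [map_smul]; exact Submodule.smul_mem _ a hx

lemma tensorBasis_repr_singVec {ℓ m : ℕ} (q κ : ℂ) (r : ℕ) :
    (tensorBasis ℓ).repr (singVec q κ ℓ m) (0, r) = if m = r then 1 else 0 := by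
  simp only [singVec, map_sum, map_smul, Finsupp.coe_finsetSum, Finset.sum_apply,
    Finsupp.smul_apply]
  rw [Finset.sum_eq_single_of_mem 0 (by simp)]
  · rw [tensorBasis_repr_tensorVec (Nat.succ_pos ℓ)]
    simp [singCoeff, Finsupp.single_apply]
  · intro j _ hj
    rcases le_or_gt j ℓ with h | h
    · rw [tensorBasis_repr_tensorVec (Nat.lt_succ_of_le h), Finsupp.single_eq_of_ne, smul_zero]
      intro h0
      exact hj (congrArg (fun p : Fin (ℓ + 1) × ℕ => (p.1 : ℕ)) h0).symm
    · simp [tensorVec, stdVec_eq_zero h]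

/-- The homomorphism `⊕_m M_{λ+ℓ-2m} → V(ℓ) ⊗ M_λ` sending the highest weight vectors to the
singular vectors. -/
def vermaSumHom (q κ : ℂ) (ℓ : ℕ) :
    ((Fin (ℓ + 1) × ℕ) →₀ ℂ) →ₗ[ℂ] (Fin (ℓ + 1) → ℂ) ⊗[ℂ] (ℕ →₀ ℂ) :=
  Finsupp.linearCombination ℂ fun p => (tensorF q ℓ ^ p.2) (singVec q κ ℓ p.1)

lemma vermaSumHom_single (q κ : ℂ) (ℓ : ℕ) (p : Fin (ℓ + 1) × ℕ) :
    vermaSumHom q κ ℓ (Finsupp.single p 1) = (tensorF q ℓ ^ p.2) (singVec q κ ℓ p.1) := by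
  simp [vermaSumHom]

lemma vermaSumHom_ED {q κ : ℂ} (hq0 : q ≠ 0) (hq : ∀ n : ℕ, 0 < n → q ^ n ≠ 1) (hκ : κ ≠ 0)
    (ℓ : ℕ) (y : (Fin (ℓ + 1) × ℕ) →₀ ℂ) :
    vermaSumHom q κ ℓ (ED q κ ℓ y) = tensorE q κ ℓ (vermaSumHom q κ ℓ y) := by
  suffices vermaSumHom q κ ℓ ∘ₗ ED q κ ℓ = tensorE q κ ℓ ∘ₗ vermaSumHom q κ ℓ from
    LinearMap.congr_fun this y
  refine Finsupp.lhom_ext' fun p => LinearMap.ext_ring ?_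
  simp only [LinearMap.comp_apply, Finsupp.lsingle_apply, ED, Finsupp.lsum_single,
    LinearMap.smul_apply, map_smul, vermaSumHom_single]
  rw [tensorE_tensorF_pow hq0 (hq 2 two_pos) hκ (singVec_mem_wtSpace q κ ℓ p.1)
    (tensorE_singVec hq0 hq hκ (Nat.lt_succ_iff.1 p.1.2))]

lemma vermaSumHom_FD (q κ : ℂ) (ℓ : ℕ) (y : (Fin (ℓ + 1) × ℕ) →₀ ℂ) :
    vermaSumHom q κ ℓ (FD ℓ y) = tensorF q ℓ (vermaSumHom q κ ℓ y) := by
  suffices vermaSumHom q κ ℓ ∘ₗ FD ℓ = tensorF q ℓ ∘ₗ vermaSumHom q κ ℓ from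
    LinearMap.congr_fun this y
  refine Finsupp.lhom_ext' fun p => LinearMap.ext_ring ?_
  simp only [LinearMap.comp_apply, Finsupp.lsingle_apply, FD, Finsupp.lsum_single,
    vermaSumHom_single, pow_succ', Module.End.mul_apply]

lemma vermaSumHom_KD {q : ℂ} (hq0 : q ≠ 0) (κ : ℂ) (ℓ : ℕ) (y : (Fin (ℓ + 1) × ℕ) →₀ ℂ) :
    vermaSumHom q κ ℓ (KD q κ ℓ y) = tensorK q κ ℓ (vermaSumHom q κ ℓ y) := by
  suffices vermaSumHom q κ ℓ ∘ₗ KD q κ ℓ = tensorK q κ ℓ ∘ₗ vermaSumHom q κ ℓ from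
    LinearMap.congr_fun this y
  refine Finsupp.lhom_ext' fun p => LinearMap.ext_ring ?_
  simp only [LinearMap.comp_apply, Finsupp.lsingle_apply, KD, Finsupp.lsum_single,
    LinearMap.smul_apply, map_smul, vermaSumHom_single]
  rw [tensorK_of_mem_wtSpace hq0 κ
    (tensorF_pow_mem_wtSpace q (singVec_mem_wtSpace q κ ℓ p.1) p.2), mul_assoc, ← zpow_add₀ hq0]
  push_cast
  ring_nf

lemma ED_apply (q κ : ℂ) (ℓ : ℕ) (y : (Fin (ℓ + 1) × ℕ) →₀ ℂ) (m : Fin (ℓ + 1)) (k : ℕ) :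
    ED q κ ℓ y (m, k) = qNum q (q ^ ((k : ℤ) + 1)) *
      qNum q (κ * q ^ ((ℓ : ℤ) - 2 * (m : ℕ)) * q ^ (-(k : ℤ))) * y (m, k + 1) := by
  induction y using Finsupp.induction_linear with
  | zero => simp
  | add x y hx hy => rw [map_add, Finsupp.add_apply, hx, hy, Finsupp.add_apply, mul_add]
  | single p c =>
    obtain ⟨n, r⟩ := p
    simp only [ED, Finsupp.lsum_single, LinearMap.smul_apply, Finsupp.lsingle_apply,
      Finsupp.smul_apply, smul_eq_mul]
    rcases r with _ | r
    · simp [qNum_one, Finsupp.single_apply]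
    · by_cases h : n = m ∧ r = k
      · obtain ⟨rfl, rfl⟩ := h
        have : 1 - ((r : ℤ) + 1) = -r := by ring
        simp [this]
      · rw [Finsupp.single_eq_of_ne, Finsupp.single_eq_of_ne, mul_zero, mul_zero]
        all_goals
          simp only [ne_eq, Prod.mk.injEq, add_tsub_cancel_right, add_left_inj]
          grind

lemma apply_eq_zero_of_ED_eq_zero {q κ : ℂ} (hq0 : q ≠ 0) (hq : ∀ n : ℕ, 0 < n → q ^ n ≠ 1)
    (hκ : κ ≠ 0) (hκ2 : κ ^ 2 = -q⁻¹) {ℓ : ℕ} {y : (Fin (ℓ + 1) × ℕ) →₀ ℂ}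
    (hy : ED q κ ℓ y = 0) (m : Fin (ℓ + 1)) (k : ℕ) : y (m, k + 1) = 0 := by
  have h := ED_apply q κ ℓ y m k
  rw [hy, Finsupp.zero_apply, mul_assoc κ, ← zpow_add₀ hq0] at h
  exact (mul_eq_zero.1 h.symm).resolve_left <| mul_ne_zero
    (qNum_zpow_ne_zero hq0 hq (by omega)) (qNum_mul_zpow_ne_zero hq0 hq hκ hκ2 _)

lemma exists_ED_pow_eq_zero (q κ : ℂ) {ℓ : ℕ} (y : (Fin (ℓ + 1) × ℕ) →₀ ℂ) :
    ∃ N, (ED q κ ℓ ^ N) y = 0 := by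
  have key : ∀ N m k, (∀ r, N ≤ r → y (m, r) = 0) →
      ∀ s, N ≤ k + s → (ED q κ ℓ ^ s) y (m, k) = 0 := by
    intro N m k hN s
    induction s generalizing k with
    | zero => exact fun h => hN k h
    | succ s ih =>
      intro h
      rw [pow_succ', Module.End.mul_apply, ED_apply, ih (k + 1) (by omega), mul_zero]
  refine ⟨y.support.sup Prod.snd + 1, Finsupp.ext fun p => ?_⟩
  refine key (y.support.sup Prod.snd + 1) p.1 p.2 (fun r hr => ?_) _ (by omega)
  by_contra hne
  have := Finset.le_sup (f := Prod.snd) (Finsupp.mem_support_iff.2 hne)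
  simp only at this
  omega

lemma vermaSumHom_injective {q κ : ℂ} (hq0 : q ≠ 0) (hq : ∀ n : ℕ, 0 < n → q ^ n ≠ 1)
    (hκ : κ ≠ 0) (hκ2 : κ ^ 2 = -q⁻¹) (ℓ : ℕ) : Function.Injective (vermaSumHom q κ ℓ) := by
  have sing : ∀ y, ED q κ ℓ y = 0 → vermaSumHom q κ ℓ y = 0 → y = 0 := by
    intro y hE hy
    have h0 := apply_eq_zero_of_ED_eq_zero hq0 hq hκ hκ2 hE
    have hsum : y = ∑ m, y (m, 0) • Finsupp.single (m, 0) 1 := by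
      ext ⟨m, k⟩
      rw [Finsupp.finsetSum_apply]
      rcases k with _ | k
      · simp [Finsupp.single_apply]
      · simp [h0]
    have hcoef : ∀ m, y (m, 0) = 0 := by
      intro m
      rw [hsum, map_sum] at hy
      simp only [map_smul, vermaSumHom_single, pow_zero, Module.End.one_apply] at hy
      have h := congrArg (fun x => (tensorBasis ℓ).repr x (0, (m : ℕ))) hy
      simpa [tensorBasis_repr_singVec, Fin.val_inj] using h
    rw [hsum]
    simp [hcoef]
  refine (injective_iff_map_eq_zero _).2 fun y hy => ?_
  obtain ⟨N, hN⟩ := exists_ED_pow_eq_zero q κ y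
  induction N generalizing y with
  | zero => simpa using hN
  | succ N ih =>
    rw [pow_succ, Module.End.mul_apply] at hN
    refine sing y (ih _ ?_ hN) hy
    rw [vermaSumHom_ED hq0 hq hκ, hy, map_zero]

lemma vermaSumHom_surjective {q κ : ℂ} (hq0 : q ≠ 0) (hq : ∀ n : ℕ, 0 < n → q ^ n ≠ 1)
    (hκ : κ ≠ 0) (hκ2 : κ ^ 2 = -q⁻¹) (ℓ : ℕ) : Function.Surjective (vermaSumHom q κ ℓ) := by
  rw [← LinearMap.range_eq_top, eq_top_iff, ← (tensorBasis ℓ).span_eq, Submodule.span_le]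
  rintro _ ⟨p, rfl⟩
  set S : Set (Fin (ℓ + 1) × ℕ) := {r | (r.1 : ℕ) + r.2 = (p.1 : ℕ) + p.2}
  have hS : S.Finite := by
    refine (Set.finite_univ.prod (Set.finite_Iic ((p.1 : ℕ) + p.2))).subset fun r hr => ?_
    simp only [S, Set.mem_ofPred_eq] at hr
    simp only [Set.mem_prod, Set.mem_univ, Set.mem_Iic, true_and]
    omega
  have : Finite S := hS
  have : Module.Finite ℂ (Finsupp.supported ℂ ℂ S) :=
    Module.Finite.equiv (Finsupp.supportedEquivFinsupp (R := ℂ) (M := ℂ) S).symm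
  let T := (tensorBasis ℓ).repr.toLinearMap ∘ₗ vermaSumHom q κ ℓ
  have hT : ∀ x ∈ Finsupp.supported ℂ ℂ S, T x ∈ Finsupp.supported ℂ ℂ S := by
    suffices Finsupp.supported ℂ ℂ S ≤ (Finsupp.supported ℂ ℂ S).comap T from fun x hx => this hx
    rw [Finsupp.supported_eq_span_single ℂ S, Submodule.span_le, ← Finsupp.supported_eq_span_single]
    rintro _ ⟨r, hr, rfl⟩
    have h := tensorBasis_repr_mem_supported
      (tensorF_pow_mem_wtSpace q (singVec_mem_wtSpace q κ ℓ r.1) r.2)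
    rw [show (r.1 : ℕ) + r.2 = (p.1 : ℕ) + p.2 from hr] at h
    simpa [T, vermaSumHom_single] using h
  have hinj : Function.Injective (T.restrict hT) := by
    intro x y hxy
    refine Subtype.ext (vermaSumHom_injective hq0 hq hκ hκ2 ℓ ?_)
    exact (tensorBasis ℓ).repr.injective (congrArg Subtype.val hxy)
  have hsurj : Function.Surjective (T.restrict hT) := LinearMap.surjective_of_injective hinj
  obtain ⟨x, hx⟩ := hsurj
    ⟨Finsupp.single p 1, Finsupp.single_mem_supported ℂ _ rfl⟩
  refine ⟨x, (tensorBasis ℓ).repr.injective ?_⟩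
  rw [Module.Basis.repr_self]
  exact congrArg Subtype.val hx

end Decomposition

/-- let `q` be not a root of unity and `Z = M_λ` the `U_q(sl2)` Verma
module of highest weight `λ` with `q^{2λ} = -q^{-1}` (`κ = q^λ`, `κ² = -q⁻¹`), `V(ℓ)`
the `(ℓ+1)`-dimensional simple module.  Then (a) for every `0 ≤ m ≤ ℓ` the extremal
twist eigenvalue `∏_{k=1}^m [λ+1+(ℓ-2m)+k]_q/[λ+1-k]_q` is nonzero, and (b)
`V(ℓ) ⊗ M_λ ≅ ⊕_{m=0}^{ℓ} M_{λ+ℓ-2m}` as `U_q(sl2)`-modules (an equivariant linear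
isomorphism, with the tensor product actions `Δ(e) = e⊗q^h + 1⊗e`,
`Δ(f) = f⊗1 + q^{-h}⊗f`, `Δ(q^h) = q^h⊗q^h`). -/
theorem tensor_with_base_Verma_decomposition (q κ : ℂ) (hq0 : q ≠ 0)
    (hq : ∀ n : ℕ, 0 < n → q ^ n ≠ 1) (hκ : κ ≠ 0) (hκ2 : κ ^ 2 = -q⁻¹) (ℓ : ℕ) :
    (∀ m : ℕ, m ≤ ℓ →
        ∏ k ∈ range m,
          (qNum q (κ * q ^ ((ℓ : ℤ) - 2 * m + k + 2)) / qNum q (κ * q ^ (-(k : ℤ)))) ≠ 0)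
      ∧ ∃ φ : TensorProduct ℂ (Fin (ℓ + 1) → ℂ) (ℕ →₀ ℂ) ≃ₗ[ℂ] ((Fin (ℓ + 1) × ℕ) →₀ ℂ),
          (∀ x, φ (((TensorProduct.map (Matrix.toLin' (EvMat q ℓ)) (KM q κ)
                + TensorProduct.map (LinearMap.id : (Fin (ℓ + 1) → ℂ) →ₗ[ℂ] (Fin (ℓ + 1) → ℂ)) (EM q κ)) :
                TensorProduct ℂ (Fin (ℓ + 1) → ℂ) (ℕ →₀ ℂ) →ₗ[ℂ] TensorProduct ℂ (Fin (ℓ + 1) → ℂ) (ℕ →₀ ℂ)) x)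
              = ED q κ ℓ (φ x))
          ∧ (∀ x, φ (((TensorProduct.map (Matrix.toLin' (FvMat ℓ))
                  (LinearMap.id : (ℕ →₀ ℂ) →ₗ[ℂ] (ℕ →₀ ℂ))
                + TensorProduct.map (Matrix.toLin' (KviMat q ℓ)) FM) :
                TensorProduct ℂ (Fin (ℓ + 1) → ℂ) (ℕ →₀ ℂ) →ₗ[ℂ] TensorProduct ℂ (Fin (ℓ + 1) → ℂ) (ℕ →₀ ℂ)) x)
              = FD ℓ (φ x))
          ∧ (∀ x, φ ((TensorProduct.map (Matrix.toLin' (KvMat q ℓ)) (KM q κ)) x)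
                = KD q κ ℓ (φ x)) := by
  refine ⟨fun m _ => Finset.prod_ne_zero_iff.2 fun k _ => div_ne_zero
    (qNum_mul_zpow_ne_zero hq0 hq hκ hκ2 _) (qNum_mul_zpow_ne_zero hq0 hq hκ hκ2 _), ?_⟩
  let ψ := LinearEquiv.ofBijective (vermaSumHom q κ ℓ)
    ⟨vermaSumHom_injective hq0 hq hκ hκ2 ℓ, vermaSumHom_surjective hq0 hq hκ hκ2 ℓ⟩
  have hψ : ∀ x, vermaSumHom q κ ℓ (ψ.symm x) = x := ψ.apply_symm_apply
  refine ⟨ψ.symm, fun x => ψ.symm_apply_eq.2 ?_, fun x => ψ.symm_apply_eq.2 ?_,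
    fun x => ψ.symm_apply_eq.2 ?_⟩
  · exact ((vermaSumHom_ED hq0 hq hκ ℓ _).trans (congrArg _ (hψ x))).symm
  · exact ((vermaSumHom_FD q κ ℓ _).trans (congrArg _ (hψ x))).symm
  · exact ((vermaSumHom_KD hq0 κ ℓ _).trans (congrArg _ (hψ x))).symm
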